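/- Let x₀ > 0 and σ < 0, and assume M_{x₀} < ∞. If u : [x₀, ∞) → ℂ is a bounded solution of u''(x) + (1+iσ)² c(x)^(−2) u(x) = 0 on [x₀, ∞), then the function S(x) := u(x) / (b(x) e^(i(1+iσ)φ(x))) is bounded, tends to 0 as x → ∞, and there exists a constant A ∈ ℂ such that S(x) = A e^(−2i(1+iσ)φ(x)) + K_σ(S)(x) for all x ≥ x₀. -/

import Mathlib

open MeasureTheory Set Filter Topology

noncomputable section

/-- The wave speed profile `c(x) = (1 + θ (x₊)^α)^(-1/2)`. -/
def spd (α θ x : ℝ) : ℝ := (1 + θ * (max x 0) ^ α) ^ (-(1 / 2) : ℝ)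

/-- The WKB amplitude `b(x) = c(x)^(1/2)`. -/
def amp (α θ x : ℝ) : ℝ := spd α θ x ^ ((1 : ℝ) / 2)

/-- The WKB phase `φ(x) = ∫₀ˣ c(y)⁻¹ dy`. -/
def phase (α θ x : ℝ) : ℝ := ∫ y in (0:ℝ)..x, (spd α θ y)⁻¹

/-- `M(x) = c(x)^(1/2) (c^(1/2))''(x)` for `x > 0`, and `0` for `x ≤ 0`. -/
def Mfun (α θ x : ℝ) : ℝ :=
  if 0 < x then
    spd α θ x ^ ((1 : ℝ) / 2) * deriv (deriv (fun y => spd α θ y ^ ((1 : ℝ) / 2))) x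
  else 0

/-- `M_{x₀} = ∫_{x₀}^∞ |M(x)| dx`. -/
def Mtail (α θ x₀ : ℝ) : ℝ := ∫ x in Ioi x₀, |Mfun α θ x|

/-- The Volterra operator `K_σ`. -/
def Kop (α θ x₀ σ : ℝ) (f : ℝ → ℂ) (x : ℝ) : ℂ :=
  (2 * Complex.I * (1 + Complex.I * (σ : ℂ)))⁻¹ *
    ((∫ y in x₀..x, (Mfun α θ y : ℂ) * f y *
        Complex.exp (-2 * Complex.I * (1 + Complex.I * (σ : ℂ)) *
          ((phase α θ x - phase α θ y : ℝ) : ℂ))) +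
      ∫ y in Ioi x, (Mfun α θ y : ℂ) * f y)

/-- The right-going WKB wave `v^> = b e^{-iφ}`. -/
def vplus (α θ x : ℝ) : ℂ := (amp α θ x : ℂ) * Complex.exp (-Complex.I * (phase α θ x : ℂ))

/-- The left-going WKB wave `v^< = b e^{iφ}`. -/
def vminus (α θ x : ℝ) : ℂ := (amp α θ x : ℂ) * Complex.exp (Complex.I * (phase α θ x : ℂ))

/-- `S` is a bounded continuous solution on `[x₀,∞)` of `S = e^{-2iφ} + K₀ S`. -/
def IsVolterraSol (α θ x₀ : ℝ) (S : ℝ → ℂ) : Prop :=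
  (∃ C, ∀ x ∈ Ici x₀, ‖S x‖ ≤ C) ∧ ContinuousOn S (Ici x₀) ∧
    ∀ x ∈ Ici x₀, S x = Complex.exp (-2 * Complex.I * (phase α θ x : ℂ)) + Kop α θ x₀ 0 S x

/-- `R_{x₀} = (2i)⁻¹ ∫_{x₀}^∞ M S^>`. -/
def Rx (α θ x₀ : ℝ) (S : ℝ → ℂ) : ℂ :=
  (2 * Complex.I)⁻¹ * ∫ x in Ioi x₀, (Mfun α θ x : ℂ) * S x

/-- The exponential `e^{kiφ}` of a differentiable real phase. -/
lemma hasDerivAt_cexp_phase {φ : ℝ → ℝ} {φ' x : ℝ} (k : ℂ) (hφ : HasDerivAt φ φ' x) :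
    HasDerivAt (fun y => Complex.exp (k * (φ y : ℂ)))
      (k * (φ' : ℂ) * Complex.exp (k * (φ x : ℂ))) x := by
  have h := (hφ.ofReal_comp.const_mul k).cexp
  convert h using 1
  ring

/-- Derivative of the Wronskian of a solution `u` with the WKB wave `b e^{ikφ}`, `φ' = b⁻²`. -/
lemma hasDerivAt_wronskian {b b' φ : ℝ → ℝ} {b'' x : ℝ} {u u' : ℝ → ℂ} (k : ℂ)
    (hbx : 0 < b x) (hb : HasDerivAt b (b' x) x) (hb' : HasDerivAt b' b'' x)
    (hφ : HasDerivAt φ ((b x ^ 2)⁻¹) x) (hu : HasDerivAt u (u' x) x)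
    (hu' : HasDerivAt u' (-k ^ 2 * ((b x : ℂ) ^ 4)⁻¹ * u x) x) :
    HasDerivAt (fun y => (u' y * b y - u y * (b' y + Complex.I * k * (b y : ℂ)⁻¹)) *
        Complex.exp (Complex.I * k * φ y))
      (-(b'' * u x * Complex.exp (Complex.I * k * φ x))) x := by
  have hb0 : (b x : ℂ) ≠ 0 := by exact_mod_cast hbx.ne'
  have hE := hasDerivAt_cexp_phase (Complex.I * k) hφ
  have hbC := hb.ofReal_comp
  have h := ((hu'.mul hbC).sub (hu.mul (hb'.ofReal_comp.add
    ((hbC.inv hb0).const_mul (Complex.I * k))))).mul hE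
  refine h.congr_deriv ?_
  simp only [Pi.mul_apply, Pi.sub_apply, Pi.add_apply, Pi.inv_apply]
  push_cast
  generalize Complex.exp (Complex.I * k * φ x) = E
  field_simp
  ring_nf
  simp only [Complex.I_sq]
  ring

/-- Derivative of the quotient of `u` by the WKB wave `b e^{ikφ}`. -/
lemma hasDerivAt_quotient {b b' φ : ℝ → ℝ} {x : ℝ} {u u' : ℝ → ℂ} (k : ℂ)
    (hbx : 0 < b x) (hb : HasDerivAt b (b' x) x)
    (hφ : HasDerivAt φ ((b x ^ 2)⁻¹) x) (hu : HasDerivAt u (u' x) x) :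
    HasDerivAt (fun y => u y / (b y * Complex.exp (Complex.I * k * φ y)))
      ((u' x * b x - u x * (b' x + Complex.I * k * (b x : ℂ)⁻¹)) *
        Complex.exp (Complex.I * k * φ x) *
        ((b x : ℂ) * Complex.exp (Complex.I * k * φ x))⁻¹ ^ 2) x := by
  have hb0 : (b x : ℂ) ≠ 0 := by exact_mod_cast hbx.ne'
  have hE := hasDerivAt_cexp_phase (Complex.I * k) hφ
  have hE0 : Complex.exp (Complex.I * k * φ x) ≠ 0 := Complex.exp_ne_zero _
  have h := hu.div (hb.ofReal_comp.mul hE) (mul_ne_zero hb0 hE0)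
  refine h.congr_deriv ?_
  simp only [Pi.mul_apply]
  push_cast
  generalize Complex.exp (Complex.I * k * φ x) = E at *
  field_simp

/-- Variation of constants for `u'' + k² b⁻⁴ u = 0` relative to the WKB wave `b e^{ikφ}`,
`φ' = b⁻²`. -/
lemma exists_volterra_eq {b b' b'' φ : ℝ → ℝ} {x₀ : ℝ} {u u' : ℝ → ℂ} {k : ℂ} (hk : k ≠ 0)
    (hb0 : ∀ x ∈ Ici x₀, 0 < b x) (hb : ∀ x ∈ Ici x₀, HasDerivAt b (b' x) x)
    (hb' : ∀ x ∈ Ici x₀, HasDerivAt b' (b'' x) x) (hb'' : ContinuousOn b'' (Ici x₀))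
    (hφ : ∀ x ∈ Ici x₀, HasDerivAt φ ((b x ^ 2)⁻¹) x)
    (hu : ∀ x ∈ Ici x₀, HasDerivAt u (u' x) x)
    (hu' : ∀ x ∈ Ici x₀, HasDerivAt u' (-k ^ 2 * ((b x : ℂ) ^ 4)⁻¹ * u x) x)
    {S : ℝ → ℂ} (hS : S = fun y => u y / (b y * Complex.exp (Complex.I * k * φ y))) :
    ∃ A B : ℂ, ∀ x ∈ Ici x₀, S x = A * Complex.exp (-2 * Complex.I * k * φ x) + B +
      (2 * Complex.I * k)⁻¹ *
        ((∫ y in x₀..x, ((b y * b'' y : ℝ) : ℂ) * S y *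
          Complex.exp (-2 * Complex.I * k * ((φ x - φ y : ℝ) : ℂ))) -
          ∫ y in x₀..x, ((b y * b'' y : ℝ) : ℂ) * S y) := by
  set W : ℝ → ℂ := fun y => (u' y * b y - u y * (b' y + Complex.I * k * (b y : ℂ)⁻¹)) *
        Complex.exp (Complex.I * k * φ y)
  set g : ℝ → ℂ := fun y => ((b y * b'' y : ℝ) : ℂ) * S y with hg
  have hSd : ∀ x ∈ Ici x₀, HasDerivAt S
      (W x * ((b x : ℂ) * Complex.exp (Complex.I * k * φ x))⁻¹ ^ 2) x := fun x hx => by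
    rw [hS]; exact hasDerivAt_quotient k (hb0 x hx) (hb x hx) (hφ x hx) (hu x hx)
  have hexp2 : ∀ x, Complex.exp (2 * Complex.I * k * φ x)
      = Complex.exp (Complex.I * k * φ x) ^ 2 := fun x => by
    rw [← Complex.exp_nat_mul]; push_cast; ring_nf
  have hexpm2 : ∀ x, Complex.exp (-2 * Complex.I * k * φ x)
      = (Complex.exp (Complex.I * k * φ x) ^ 2)⁻¹ := fun x => by
    rw [← hexp2, ← Complex.exp_neg]; ring_nf
  have hWd : ∀ x ∈ Ici x₀, HasDerivAt W
      (-(g x * Complex.exp (2 * Complex.I * k * φ x))) x := fun x hx => by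
    refine (hasDerivAt_wronskian k (hb0 x hx) (hb x hx) (hb' x hx) (hφ x hx) (hu x hx)
      (hu' x hx)).congr_deriv ?_
    have h0 : (b x : ℂ) ≠ 0 := by exact_mod_cast (hb0 x hx).ne'
    have hE0 : Complex.exp (Complex.I * k * φ x) ≠ 0 := Complex.exp_ne_zero _
    simp only [hg, hS, hexp2]
    push_cast
    field_simp
  have hTd : ∀ x ∈ Ici x₀, HasDerivAt
      (fun y => S y + (2 * Complex.I * k)⁻¹ * (Complex.exp (-2 * Complex.I * k * φ y) * W y))
      (-((2 * Complex.I * k)⁻¹ * g x)) x := fun x hx => by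
    refine ((hSd x hx).add (((hasDerivAt_cexp_phase (-2 * Complex.I * k) (hφ x hx)).mul
      (hWd x hx)).const_mul ((2 * Complex.I * k)⁻¹))).congr_deriv ?_
    have h0 : (b x : ℂ) ≠ 0 := by exact_mod_cast (hb0 x hx).ne'
    have hE0 : Complex.exp (Complex.I * k * φ x) ≠ 0 := Complex.exp_ne_zero _
    have hI := Complex.I_ne_zero
    rw [hexp2, hexpm2]
    generalize W x = w
    push_cast
    field_simp
    ring
  have hφc : ContinuousOn φ (Ici x₀) := fun x hx => (hφ x hx).continuousAt.continuousWithinAt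
  have hgc : ContinuousOn g (Ici x₀) :=
    (Complex.continuous_ofReal.comp_continuousOn
      (ContinuousOn.mul (fun x hx => (hb x hx).continuousAt.continuousWithinAt) hb'')).mul
      (fun x hx => (hSd x hx).continuousAt.continuousWithinAt)
  have hgEc : ContinuousOn (fun x => g x * Complex.exp (2 * Complex.I * k * φ x)) (Ici x₀) :=
    hgc.mul (by fun_prop)
  refine ⟨-(2 * Complex.I * k)⁻¹ * W x₀,
    S x₀ + (2 * Complex.I * k)⁻¹ * (Complex.exp (-2 * Complex.I * k * φ x₀) * W x₀),
    fun x hx => ?_⟩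
  have hsub : uIcc x₀ x ⊆ Ici x₀ := by
    rw [uIcc_of_le hx]; exact Icc_subset_Ici_self
  have h1 := intervalIntegral.integral_eq_sub_of_hasDerivAt (fun y hy => hWd y (hsub hy))
    (hgEc.neg.mono hsub).intervalIntegrable
  have h2 := intervalIntegral.integral_eq_sub_of_hasDerivAt (fun y hy => hTd y (hsub hy))
    ((continuousOn_const.mul hgc).neg.mono hsub).intervalIntegrable
  rw [intervalIntegral.integral_neg] at h1 h2
  rw [intervalIntegral.integral_const_mul] at h2
  have h3 : (∫ y in x₀..x, g y * Complex.exp (-2 * Complex.I * k * ((φ x - φ y : ℝ) : ℂ)))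
      = Complex.exp (-2 * Complex.I * k * φ x) *
        ∫ y in x₀..x, g y * Complex.exp (2 * Complex.I * k * φ y) := by
    rw [← intervalIntegral.integral_const_mul]
    refine intervalIntegral.integral_congr fun y _ => ?_
    rw [mul_left_comm, ← Complex.exp_add]
    push_cast
    ring_nf
  rw [h3]
  clear_value W
  linear_combination (Complex.exp (-2 * Complex.I * k * φ x) * (2 * Complex.I * k)⁻¹) * h1 - h2

/-- An exponentially damped convolution of an integrable function vanishes at infinity. -/
lemma tendsto_integral_mul_cexp_phase {φ : ℝ → ℝ} {x₀ : ℝ} {g : ℝ → ℂ} {m : ℂ}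
    (hm : m.re < 0) (hφ : ContinuousOn φ (Ici x₀)) (hmono : MonotoneOn φ (Ici x₀))
    (hφt : Tendsto φ atTop atTop) (hg : IntegrableOn g (Ioi x₀)) :
    Tendsto (fun x => ∫ y in x₀..x, g y * Complex.exp (m * ((φ x - φ y : ℝ) : ℂ)))
      atTop (𝓝 0) := by
  have hnorm : ∀ x y, ‖Complex.exp (m * ((φ x - φ y : ℝ) : ℂ))‖ =
      Real.exp (m.re * (φ x - φ y)) := fun x y => by
    rw [Complex.norm_exp, Complex.re_mul_ofReal]
  have key : Tendsto (fun x => ∫ y in Ioi x₀, (Iic x).indicator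
      (fun y => g y * Complex.exp (m * ((φ x - φ y : ℝ) : ℂ))) y) atTop
      (𝓝 (∫ _ in Ioi x₀, (0 : ℂ))) := by
    refine tendsto_integral_filter_of_dominated_convergence (fun y => ‖g y‖) ?_ ?_ hg.norm ?_
    · refine Eventually.of_forall fun x => ?_
      refine AEStronglyMeasurable.indicator ?_ measurableSet_Iic
      refine hg.aestronglyMeasurable.mul (ContinuousOn.aestronglyMeasurable ?_ measurableSet_Ioi)
      have := hφ.mono Ioi_subset_Ici_self
      fun_prop
    · filter_upwards [eventually_ge_atTop x₀] with x hx
      filter_upwards [ae_restrict_mem measurableSet_Ioi] with y hy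
      by_cases hyx : y ≤ x
      · rw [indicator_of_mem (mem_Iic.2 hyx), norm_mul, hnorm]
        refine mul_le_of_le_one_right (norm_nonneg _) (Real.exp_le_one_iff.2 ?_)
        exact mul_nonpos_of_nonpos_of_nonneg hm.le
          (sub_nonneg.2 (hmono (mem_Ioi.1 hy).le hx hyx))
      · rw [indicator_of_notMem (by simpa using hyx)]
        simp
    · filter_upwards with y
      have : Tendsto (fun x => g y * Complex.exp (m * ((φ x - φ y : ℝ) : ℂ))) atTop (𝓝 0) := by
        have h0 : Tendsto (fun x => Complex.exp (m * ((φ x - φ y : ℝ) : ℂ))) atTop (𝓝 0) := by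
          rw [tendsto_zero_iff_norm_tendsto_zero]
          simp only [hnorm]
          refine Real.tendsto_exp_atBot.comp ?_
          exact (tendsto_atTop_add_const_right _ (-φ y) hφt).const_mul_atTop_of_neg hm
        simpa using h0.const_mul (g y)
      refine this.congr' ?_
      filter_upwards [eventually_ge_atTop y] with x hx
      rw [indicator_of_mem (mem_Iic.2 hx)]
  rw [integral_zero] at key
  refine key.congr' ?_
  filter_upwards [eventually_ge_atTop x₀] with x hx
  rw [intervalIntegral.integral_of_le hx, integral_indicator measurableSet_Iic,
    Measure.restrict_restrict measurableSet_Iic, inter_comm, Ioi_inter_Iic]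

section Profile

variable {α θ : ℝ}

lemma one_le_profile (hθ : 0 < θ) (x : ℝ) : 1 ≤ 1 + θ * (max x 0) ^ α := by
  have := Real.rpow_nonneg (le_max_right x 0) α
  nlinarith [mul_nonneg hθ.le this]

lemma spd_pos (hθ : 0 < θ) (x : ℝ) : 0 < spd α θ x :=
  Real.rpow_pos_of_pos (zero_lt_one.trans_le (one_le_profile hθ x)) _

lemma spd_le_one (hθ : 0 < θ) (x : ℝ) : spd α θ x ≤ 1 :=
  Real.rpow_le_one_of_one_le_of_nonpos (one_le_profile hθ x) (by norm_num)

lemma amp_pos (hθ : 0 < θ) (x : ℝ) : 0 < amp α θ x :=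
  Real.rpow_pos_of_pos (spd_pos hθ x) _

lemma amp_sq (hθ : 0 < θ) (x : ℝ) : amp α θ x ^ 2 = spd α θ x := by
  rw [amp, ← Real.sqrt_eq_rpow, Real.sq_sqrt (spd_pos hθ x).le]

lemma inv_amp_le (hθ : 0 < θ) (x : ℝ) : (amp α θ x)⁻¹ ≤ 1 + θ * (max x 0) ^ α := by
  have h := one_le_profile (α := α) hθ x
  rw [amp, spd, ← Real.rpow_mul (by linarith), ← Real.rpow_neg (by linarith)]
  exact (Real.rpow_le_rpow_of_exponent_le h (by norm_num)).trans_eq (Real.rpow_one _)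

lemma continuous_spd (hα : 0 < α) (hθ : 0 < θ) : Continuous (spd α θ) := by
  unfold spd
  refine Continuous.rpow_const (continuous_const.add (continuous_const.mul
    ((continuous_id.max continuous_const).rpow_const fun _ => Or.inr hα.le))) fun x => Or.inl ?_
  exact (zero_lt_one.trans_le (one_le_profile hθ x)).ne'

lemma continuous_inv_spd (hα : 0 < α) (hθ : 0 < θ) : Continuous fun x => (spd α θ x)⁻¹ :=
  (continuous_spd hα hθ).inv₀ fun x => (spd_pos hθ x).ne'

lemma hasDerivAt_phase (hα : 0 < α) (hθ : 0 < θ) (x : ℝ) :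
    HasDerivAt (phase α θ) (spd α θ x)⁻¹ x :=
  (continuous_inv_spd hα hθ).integral_hasStrictDerivAt 0 x |>.hasDerivAt

lemma monotone_phase (hα : 0 < α) (hθ : 0 < θ) : Monotone (phase α θ) :=
  monotone_of_hasDerivAt_nonneg (hasDerivAt_phase hα hθ) fun x => inv_nonneg.2 (spd_pos hθ x).le

lemma le_phase (hα : 0 < α) (hθ : 0 < θ) {x : ℝ} (hx : 0 ≤ x) : x ≤ phase α θ x := by
  have h : ∫ _ in (0 : ℝ)..x, (1 : ℝ) ≤ phase α θ x :=
    intervalIntegral.integral_mono_on hx (by simp)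
      ((continuous_inv_spd hα hθ).intervalIntegrable _ _)
      fun y _ => (one_le_inv₀ (spd_pos hθ y)).2 (spd_le_one hθ y)
  simpa using h

lemma tendsto_phase (hα : 0 < α) (hθ : 0 < θ) : Tendsto (phase α θ) atTop atTop :=
  tendsto_atTop_mono' _ ((eventually_ge_atTop 0).mono fun _ hx => le_phase hα hθ hx) tendsto_id

lemma contDiffOn_amp (hθ : 0 < θ) : ContDiffOn ℝ 2 (amp α θ) (Ioi 0) := by
  have h : ContDiffOn ℝ 2 (fun x : ℝ => ((1 + θ * x ^ α) ^ (-(1 / 2) : ℝ)) ^ ((1 : ℝ) / 2))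
      (Ioi 0) := by
    intro x hx
    have hp : 0 < 1 + θ * x ^ α := by
      have := Real.rpow_pos_of_pos hx α
      positivity
    have hx' : x ≠ 0 := (mem_Ioi.1 hx).ne'
    refine ContDiffAt.contDiffWithinAt ?_
    refine ContDiffAt.rpow_const_of_ne (ContDiffAt.rpow_const_of_ne
      (contDiffAt_const.add (contDiffAt_const.mul
        (contDiffAt_id.rpow_const_of_ne hx'))) hp.ne') ?_
    exact (Real.rpow_pos_of_pos hp _).ne'
  refine h.congr fun x hx => ?_
  simp only [amp, spd, max_eq_left (le_of_lt (mem_Ioi.1 hx))]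

lemma contDiffOn_deriv_amp (hθ : 0 < θ) : ContDiffOn ℝ 1 (deriv (amp α θ)) (Ioi 0) :=
  ((contDiffOn_succ_iff_deriv_of_isOpen (n := 1) isOpen_Ioi).1 (contDiffOn_amp hθ)).2.2

lemma Mfun_eq {x : ℝ} (hx : 0 < x) :
    Mfun α θ x = amp α θ x * deriv (deriv (amp α θ)) x := if_pos hx

end Profile

/-- bounded solutions satisfy the Volterra equation. -/
theorem stmt1 (α θ x₀ σ : ℝ) (hα : 0 < α) (hθ : 0 < θ) (hx₀ : 0 < x₀) (hσ : σ < 0)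
    (hM : IntegrableOn (fun x => |Mfun α θ x|) (Ioi x₀))
    (u u' : ℝ → ℂ)
    (hu : ∀ x ∈ Ici x₀, HasDerivAt u (u' x) x)
    (hu' : ∀ x ∈ Ici x₀,
      HasDerivAt u' (-(1 + Complex.I * (σ : ℂ)) ^ 2 * ((spd α θ x : ℂ))⁻¹ ^ 2 * u x) x)
    (hbd : ∃ C, ∀ x ∈ Ici x₀, ‖u x‖ ≤ C) :
    (∃ C, ∀ x ∈ Ici x₀,
        ‖u x / ((amp α θ x : ℂ) *
            Complex.exp (Complex.I * (1 + Complex.I * (σ : ℂ)) * (phase α θ x : ℂ)))‖ ≤ C) ∧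
    Tendsto (fun x => u x / ((amp α θ x : ℂ) *
        Complex.exp (Complex.I * (1 + Complex.I * (σ : ℂ)) * (phase α θ x : ℂ))))
      atTop (𝓝 0) ∧
    ∃ A : ℂ, ∀ x ∈ Ici x₀,
      u x / ((amp α θ x : ℂ) *
          Complex.exp (Complex.I * (1 + Complex.I * (σ : ℂ)) * (phase α θ x : ℂ))) =
        A * Complex.exp (-2 * Complex.I * (1 + Complex.I * (σ : ℂ)) * (phase α θ x : ℂ)) +
          Kop α θ x₀ σ
            (fun y => u y / ((amp α θ y : ℂ) *
              Complex.exp (Complex.I * (1 + Complex.I * (σ : ℂ)) * (phase α θ y : ℂ)))) x := by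
  set k : ℂ := 1 + Complex.I * (σ : ℂ) with hk
  set S : ℝ → ℂ := fun x => u x / ((amp α θ x : ℂ) *
        Complex.exp (Complex.I * k * (phase α θ x : ℂ))) with hS
  obtain ⟨C, hC⟩ := hbd
  have hk0 : k ≠ 0 := fun h => by simpa [hk] using congrArg Complex.re h
  have hpos : ∀ x ∈ Ici x₀, 0 < x := fun x hx => hx₀.trans_le hx
  have hφ : ∀ x ∈ Ici x₀, HasDerivAt (phase α θ) ((amp α θ x ^ 2)⁻¹) x := fun x _ => by
    rw [amp_sq hθ]; exact hasDerivAt_phase hα hθ x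
  have hb : ∀ x ∈ Ici x₀, HasDerivAt (amp α θ) (deriv (amp α θ) x) x := fun x hx =>
    (((contDiffOn_amp hθ).differentiableOn (by norm_num)).differentiableAt
      (Ioi_mem_nhds (hpos x hx))).hasDerivAt
  have hb' : ∀ x ∈ Ici x₀, HasDerivAt (deriv (amp α θ)) (deriv (deriv (amp α θ)) x) x :=
    fun x hx => (((contDiffOn_deriv_amp hθ).differentiableOn (by norm_num)).differentiableAt
      (Ioi_mem_nhds (hpos x hx))).hasDerivAt
  have hb'' : ContinuousOn (deriv (deriv (amp α θ))) (Ici x₀) :=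
    ((contDiffOn_deriv_amp hθ).continuousOn_deriv_of_isOpen isOpen_Ioi le_rfl).mono hpos
  have hScont : ContinuousOn S (Ici x₀) := fun x hx =>
    (hasDerivAt_quotient k (amp_pos hθ x) (hb x hx) (hφ x hx)
      (hu x hx)).continuousAt.continuousWithinAt
  have hSle : ∀ x ∈ Ici x₀, ‖S x‖ ≤ C * ((1 + θ * x ^ α) * Real.exp (σ * x)) := fun x hx => by
    have h0 : 0 ≤ C := (norm_nonneg _).trans (hC x hx)
    have hx0 := (hpos x hx).le
    have hre : (Complex.I * k * (phase α θ x : ℂ)).re = -(σ * phase α θ x) := by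
      simp [hk]
    have h1 := inv_amp_le (α := α) hθ x
    rw [max_eq_left hx0] at h1
    have h2 : Real.exp (σ * phase α θ x) ≤ Real.exp (σ * x) :=
      Real.exp_le_exp.2 (mul_le_mul_of_nonpos_left (le_phase hα hθ hx0) hσ.le)
    have h3 : 0 ≤ x ^ α := Real.rpow_nonneg hx0 α
    calc ‖S x‖ = ‖u x‖ * ((amp α θ x)⁻¹ * Real.exp (σ * phase α θ x)) := by
          rw [hS]
          simp only [norm_div, norm_mul, Complex.norm_exp, hre, Complex.norm_real,
            Real.norm_eq_abs, abs_of_pos (amp_pos hθ x), Real.exp_neg]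
          rw [div_eq_mul_inv, mul_inv, inv_inv]
      _ ≤ _ := by
          have h4 := inv_nonneg.2 (amp_pos (α := α) hθ x).le
          gcongr
          exact hC x hx
  have hSlim : Tendsto S atTop (𝓝 0) := by
    have h1 := tendsto_rpow_mul_exp_neg_mul_atTop_nhds_zero 0 (-σ) (by linarith)
    have h2 := tendsto_rpow_mul_exp_neg_mul_atTop_nhds_zero α (-σ) (by linarith)
    have h3 := (h1.add (h2.const_mul θ)).const_mul C
    simp only [Real.rpow_zero, neg_neg, mul_zero, add_zero] at h3
    refine squeeze_zero_norm' ?_ h3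
    filter_upwards [eventually_ge_atTop x₀] with x hx
    exact (hSle x hx).trans_eq (by ring)
  have hSbd : ∃ C, ∀ x ∈ Ici x₀, ‖S x‖ ≤ C := by
    obtain ⟨N, hN⟩ := eventually_atTop.1
      ((tendsto_zero_iff_norm_tendsto_zero.1 hSlim).eventually_le_const zero_lt_one)
    obtain ⟨D, hD⟩ := isCompact_Icc.exists_bound_of_continuousOn
      (hScont.mono (Icc_subset_Ici_self : Icc x₀ N ⊆ Ici x₀))
    refine ⟨max D 1, fun x hx => ?_⟩
    rcases le_total x N with h | h
    · exact (hD x ⟨hx, h⟩).trans (le_max_left _ _)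
    · exact (hN x h).trans (le_max_right _ _)
  refine ⟨hSbd, hSlim, ?_⟩
  have hMeq : ∀ x ∈ Ici x₀, Mfun α θ x = amp α θ x * deriv (deriv (amp α θ)) x :=
    fun x hx => Mfun_eq (hpos x hx)
  have hMcont : ContinuousOn (Mfun α θ) (Ici x₀) :=
    ContinuousOn.congr (ContinuousOn.mul
      (fun x hx => (hb x hx).continuousAt.continuousWithinAt) hb'') hMeq
  obtain ⟨D, hD⟩ := hSbd
  have hint : IntegrableOn (fun y => (Mfun α θ y : ℂ) * S y) (Ioi x₀) := by
    have hc : ContinuousOn (fun y => (Mfun α θ y : ℂ) * S y) (Ioi x₀) :=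
      ((Complex.continuous_ofReal.comp_continuousOn hMcont).mul hScont).mono Ioi_subset_Ici_self
    refine Integrable.mono' (hM.mul_const D) (hc.aestronglyMeasurable measurableSet_Ioi) ?_
    filter_upwards [ae_restrict_mem measurableSet_Ioi] with y hy
    rw [norm_mul, Complex.norm_real, Real.norm_eq_abs]
    exact mul_le_mul_of_nonneg_left (hD y (mem_Ioi.1 hy).le) (abs_nonneg _)
  obtain ⟨A, B, hAB⟩ := exists_volterra_eq hk0 (fun x _ => amp_pos hθ x) hb hb' hb'' hφ hu
    (fun x hx => by
      refine (hu' x hx).congr_deriv ?_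
      rw [← amp_sq hθ]
      push_cast
      rw [inv_pow, ← pow_mul]) hS
  have hAB' : ∀ x ∈ Ici x₀, S x = A * Complex.exp (-2 * Complex.I * k * (phase α θ x : ℂ)) +
      (B - (2 * Complex.I * k)⁻¹ * ∫ y in Ioi x₀, (Mfun α θ y : ℂ) * S y) +
      Kop α θ x₀ σ S x := fun x hx => by
    have e1 := intervalIntegral.integral_Ioi_sub_Ioi hint hx
    have hsub : ∀ y ∈ uIcc x₀ x, y ∈ Ici x₀ := fun y hy => by
      rw [uIcc_of_le hx] at hy; exact hy.1
    have e2 : (∫ y in x₀..x, ((amp α θ y * deriv (deriv (amp α θ)) y : ℝ) : ℂ) * S y) =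
        ∫ y in x₀..x, (Mfun α θ y : ℂ) * S y :=
      intervalIntegral.integral_congr fun y hy => by
        simp only [hMeq y (hsub y hy)]
    have e3 : (∫ y in x₀..x, ((amp α θ y * deriv (deriv (amp α θ)) y : ℝ) : ℂ) * S y *
          Complex.exp (-2 * Complex.I * k * ((phase α θ x - phase α θ y : ℝ) : ℂ))) =
        ∫ y in x₀..x, (Mfun α θ y : ℂ) * S y *
          Complex.exp (-2 * Complex.I * k * ((phase α θ x - phase α θ y : ℝ) : ℂ)) :=
      intervalIntegral.integral_congr fun y hy => by
        simp only [hMeq y (hsub y hy)]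
    have h := hAB x hx
    rw [e2, e3] at h
    rw [h, Kop, ← hk]
    linear_combination (2 * Complex.I * k)⁻¹ * e1
  have hre : (-2 * Complex.I * k).re < 0 := by
    simp only [hk]
    norm_num
    linarith
  have hKlim : Tendsto (Kop α θ x₀ σ S) atTop (𝓝 0) := by
    have l1 := tendsto_integral_mul_cexp_phase hre
      (fun x hx => (hφ x hx).continuousAt.continuousWithinAt)
      ((monotone_phase hα hθ).monotoneOn _) (tendsto_phase hα hθ) hint
    have l2 : Tendsto (fun x => ∫ y in Ioi x, (Mfun α θ y : ℂ) * S y) atTop (𝓝 0) := by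
      have l := (intervalIntegral_tendsto_integral_Ioi x₀ hint tendsto_id).const_sub
        (∫ y in Ioi x₀, (Mfun α θ y : ℂ) * S y)
      rw [sub_self] at l
      refine l.congr' ?_
      filter_upwards [eventually_ge_atTop x₀] with x hx
      rw [id, ← intervalIntegral.integral_Ioi_sub_Ioi hint hx, sub_sub_cancel]
    have l := (l1.add l2).const_mul (2 * Complex.I * k)⁻¹
    rw [add_zero, mul_zero] at l
    exact l
  have hElim : Tendsto (fun x => Complex.exp (-2 * Complex.I * k * (phase α θ x : ℂ)))
      atTop (𝓝 0) := by
    rw [tendsto_zero_iff_norm_tendsto_zero]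
    simp only [Complex.norm_exp, Complex.re_mul_ofReal]
    exact Real.tendsto_exp_atBot.comp ((tendsto_phase hα hθ).const_mul_atTop_of_neg hre)
  have hB : B - (2 * Complex.I * k)⁻¹ * ∫ y in Ioi x₀, (Mfun α θ y : ℂ) * S y = 0 := by
    have l := (hSlim.sub (hElim.const_mul A)).sub hKlim
    simp only [mul_zero, sub_zero] at l
    refine tendsto_nhds_unique (tendsto_const_nhds.congr' ?_) l
    filter_upwards [eventually_ge_atTop x₀] with x hx
    linear_combination -hAB' x hx
  refine ⟨A, fun x hx => ?_⟩
  have h := hAB' x hx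
  rwa [hB, add_zero] at h
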